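/- Let K be a field of characteristic ≠ 2, G a group, T : G → K a 2-dimensional pseudo-representation, and σ* ∈ G an element with (σ*)² = 1 and T(σ*) = 0. Suppose there exist σ₀, τ₀ ∈ G with x(σ₀,τ₀) ≠ 0. Define ρ(σ) to be the 2×2 matrix with rows (a(σ), x(σ,τ₀)/x(σ₀,τ₀)) and (x(σ₀,σ), d(σ)). Then ρ is a group homomorphism G → GL₂(K) with tr(ρ(σ)) = T(σ) and det(ρ(σ)) = (1/2)(T(σ)² − T(σ²)) for all σ ∈ G; moreover ρ is absolutely irreducible, i.e. for every field extension L of K there is no one-dimensional L-subspace of L² stable under ρ(g) for all g ∈ G. -/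

import Mathlib

section PseudoRep

variable {K : Type*} [Field K] {G : Type*} [Group G]

/-- `a(σ) = (1/2)(T(σ*σ) + T(σ))`. -/
noncomputable def aPR (T : G → K) (σs σ : G) : K :=
  Ring.inverse 2 * (T (σs * σ) + T σ)

/-- `d(σ) = (1/2)(−T(σ*σ) + T(σ)) = T(σ) − a(σ)`. -/
noncomputable def dPR (T : G → K) (σs σ : G) : K :=
  T σ - aPR T σs σ

/-- `x(σ,τ) = a(στ) − a(σ)a(τ)`. -/
noncomputable def xPR (T : G → K) (σs σ τ : G) : K :=
  aPR T σs (σ * τ) - aPR T σs σ * aPR T σs τ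

namespace PeirceForm

/-! Given a trace form `φ` on an algebra and `e + f = 1` such that `φ` is multiplicative on the
corners cut out by `e` and by `f`, the functions `φ (e * X)`, `φ (f * X)` and `φ (e * X * f * Y)`
multiply like the entries of a `2 × 2` matrix. -/

variable {A : Type*} [Ring A] [Algebra K A] {φ : A →ₗ[K] K} {e f : A}

theorem mul_eq_add (hef : e + f = 1) (X Y : A) : X * Y = X * e * Y + X * f * Y := by
  rw [← add_mul, ← mul_add, hef, mul_one]

theorem offDiag_mul_left (hφ : ∀ X Y, φ (X * Y) = φ (Y * X)) (hef : e + f = 1)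
    (he : ∀ X Y, φ (e * X * e * Y) = φ (e * X) * φ (e * Y))
    (hf : ∀ X Y, φ (f * X * f * Y) = φ (f * X) * φ (f * Y)) (X Y Z : A) :
    φ (e * (X * Y) * f * Z) = φ (e * X) * φ (e * Y * f * Z) + φ (e * X * f * Z) * φ (f * Y) := by
  have h₁ := he X (Y * f * Z)
  have h₂ := hf Y (Z * e * X)
  have h₃ := hφ (f * Y * f * Z) (e * X)
  have h₄ := hφ (f * Z) (e * X)
  have h₅ := congrArg φ (mul_eq_add hef (e * X) (Y * f * Z))
  simp only [mul_assoc, map_add] at *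
  linear_combination h₅ + h₁ + h₂ - h₃ + φ (f * Y) * h₄

theorem offDiag_mul_right (hφ : ∀ X Y, φ (X * Y) = φ (Y * X)) (hef : e + f = 1)
    (he : ∀ X Y, φ (e * X * e * Y) = φ (e * X) * φ (e * Y))
    (hf : ∀ X Y, φ (f * X * f * Y) = φ (f * X) * φ (f * Y)) (X Y Z : A) :
    φ (e * X * f * (Y * Z)) = φ (e * X * f * Y) * φ (e * Z) + φ (f * Y) * φ (e * X * f * Z) := by
  have h₁ := he (X * f * Y) Z
  have h₂ := hf Y (Z * e * X)
  have h₃ := hφ (f * Y * f * Z) (e * X)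
  have h₄ := hφ (f * Z) (e * X)
  have h₅ := congrArg φ (mul_eq_add hef (e * X * f * Y) Z)
  simp only [mul_assoc, map_add] at *
  linear_combination h₅ + h₁ + h₂ - h₃ + φ (f * Y) * h₄

theorem offDiag_mul_offDiag (hφ : ∀ X Y, φ (X * Y) = φ (Y * X))
    (he : ∀ X Y, φ (e * X * e * Y) = φ (e * X) * φ (e * Y))
    (hf : ∀ X Y, φ (f * X * f * Y) = φ (f * X) * φ (f * Y)) (W X Y Z : A) :
    φ (e * W * f * X) * φ (e * Y * f * Z) = φ (e * W * f * Z) * φ (e * Y * f * X) := by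
  have h₁ := he (W * f * X) (Y * f * Z)
  have h₂ := hf (X * e * Y) (Z * e * W)
  have h₃ := hφ (f * X * e * Y * f * Z) (e * W)
  have h₄ := hφ (f * X) (e * Y)
  have h₅ := hφ (f * Z) (e * W)
  simp only [mul_assoc] at *
  rw [h₄, h₅] at h₂
  linear_combination - h₁ + h₂ - h₃

theorem diag_mul (hφ : ∀ X Y, φ (X * Y) = φ (Y * X)) (hef : e + f = 1)
    (hf : ∀ X Y, φ (f * X * f * Y) = φ (f * X) * φ (f * Y)) (X Y : A) :
    φ (f * (X * Y)) = φ (f * X) * φ (f * Y) + φ (e * Y * f * X) := by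
  have h₁ := hf X Y
  have h₂ := hφ (f * X) (e * Y)
  have h₃ := congrArg φ (mul_eq_add hef (f * X) Y)
  simp only [mul_assoc, map_add] at *
  linear_combination h₃ + h₁ + h₂

end PeirceForm

namespace MonoidAlgebra

theorem bilin_ext {B C : MonoidAlgebra K G →ₗ[K] MonoidAlgebra K G →ₗ[K] K}
    (h : ∀ σ τ : G, B (of K G σ) (of K G τ) = C (of K G σ) (of K G τ)) : B = C := by
  ext σ τ
  simpa using h σ τ

/-- The linear extension of `T : G → K` to the group algebra. -/
noncomputable def extend (T : G → K) : MonoidAlgebra K G →ₗ[K] K :=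
  (MonoidAlgebra.basis G K).constr K T

theorem extend_of (T : G → K) (σ : G) : extend T (of K G σ) = T σ := by
  rw [extend, of_apply, ← basis_apply, Module.Basis.constr_basis]

theorem extend_mul_comm {T : G → K} (hTcomm : ∀ σ τ : G, T (σ * τ) = T (τ * σ))
    (X Y : MonoidAlgebra K G) : extend T (X * Y) = extend T (Y * X) := by
  have h : (LinearMap.mul K (MonoidAlgebra K G)).compr₂ (extend T) =
      (LinearMap.mul K (MonoidAlgebra K G)).flip.compr₂ (extend T) :=
    bilin_ext fun σ τ => by
      simpa [← map_mul, extend_of, -of_apply] using hTcomm σ τ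
  exact LinearMap.congr_fun₂ h X Y

theorem extend_corner_mul {T : G → K} {e : MonoidAlgebra K G}
    (h : ∀ σ τ : G, extend T (e * of K G σ * e * of K G τ) =
      extend T (e * of K G σ) * extend T (e * of K G τ))
    (X Y : MonoidAlgebra K G) :
    extend T (e * X * e * Y) = extend T (e * X) * extend T (e * Y) := by
  have hB : ((LinearMap.mul K (MonoidAlgebra K G)).compl₁₂
        (LinearMap.mulLeft K e) (LinearMap.mulLeft K e)).compr₂ (extend T) =
      (LinearMap.mul K K).compl₁₂ (extend T ∘ₗ LinearMap.mulLeft K e)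
        (extend T ∘ₗ LinearMap.mulLeft K e) :=
    bilin_ext fun σ τ => by
      simpa [mul_assoc, -of_apply] using h σ τ
  simpa [mul_assoc] using LinearMap.congr_fun₂ hB X Y

end MonoidAlgebra

namespace PseudoRep

theorem conj_mul {T : G → K} (hTcomm : ∀ σ τ : G, T (σ * τ) = T (τ * σ))
    (hTrel : ∀ γ δ η : G,
      T (γ * δ * η) + T (γ * η * δ) - T (γ * η) * T δ - T (η * δ) * T γ -
        T (δ * γ) * T η + T γ * T δ * T η = 0)
    {σs : G} (hσs : σs * σs = 1) (hTσs : T σs = 0) (σ τ : G) :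
    T (σs * σ * σs * τ) = T (σs * σ) * T (σs * τ) + T σ * T τ - T (σ * τ) := by
  have h := hTrel σs (σs * τ) σ
  have h₁ : T (σs * τ * σs) = T τ := by rw [hTcomm, ← mul_assoc, hσs, one_mul]
  rw [hTσs, h₁, ← mul_assoc σs σs, hσs, one_mul, ← mul_assoc (σs * σ), hTcomm τ σ] at h
  linear_combination h

theorem involution_mul_add {T : G → K} (hTcomm : ∀ σ τ : G, T (σ * τ) = T (τ * σ))
    (hTrel : ∀ γ δ η : G,
      T (γ * δ * η) + T (γ * η * δ) - T (γ * η) * T δ - T (η * δ) * T γ -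
        T (δ * γ) * T η + T γ * T δ * T η = 0)
    {σs : G} (hTσs : T σs = 0) (σ τ : G) :
    T (σs * σ * τ) + T (σ * σs * τ) = T (σs * σ) * T τ + T (σs * τ) * T σ := by
  have h := hTrel σs σ τ
  have h₁ : T (σs * τ * σ) = T (σ * σs * τ) := by rw [hTcomm, mul_assoc]
  rw [hTσs, h₁, hTcomm σ σs] at h
  linear_combination h

open MonoidAlgebra in
/-- The corner `(1 + c σ*) / 2` of the group algebra, for `c = ± 1`. -/
noncomputable def corner (σs : G) (c : K) : MonoidAlgebra K G :=
  (2⁻¹ : K) • (1 + c • of K G σs)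

open MonoidAlgebra in
theorem extend_corner (T : G → K) (σs : G) (c : K) (σ : G) :
    extend T (corner σs c * of K G σ) = 2⁻¹ * (T σ + c * T (σs * σ)) := by
  simp only [corner, smul_mul_assoc, add_mul, one_mul, ← map_mul, map_smul, map_add, extend_of,
    smul_eq_mul]

open MonoidAlgebra in
theorem extend_corner_mul_corner (T : G → K) (σs : G) (b c : K) (σ τ : G) :
    extend T (corner σs b * of K G σ * corner σs c * of K G τ) =
      2⁻¹ * 2⁻¹ * (T (σ * τ) + b * T (σs * σ * τ) + c * T (σ * σs * τ) +
        b * c * T (σs * σ * σs * τ)) := by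
  simp only [corner, smul_mul_assoc, mul_smul_comm, add_mul, mul_add, one_mul, mul_one, ← map_mul,
    map_smul, map_add, extend_of, smul_eq_mul, smul_add]
  ring

theorem corner_mul {T : G → K} (hTcomm : ∀ σ τ : G, T (σ * τ) = T (τ * σ))
    (hTrel : ∀ γ δ η : G,
      T (γ * δ * η) + T (γ * η * δ) - T (γ * η) * T δ - T (η * δ) * T γ -
        T (δ * γ) * T η + T γ * T δ * T η = 0)
    {σs : G} (hσs : σs * σs = 1) (hTσs : T σs = 0) {c : K} (hc : c * c = 1)
    (X Y : MonoidAlgebra K G) :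
    MonoidAlgebra.extend T (corner σs c * X * corner σs c * Y) =
      MonoidAlgebra.extend T (corner σs c * X) * MonoidAlgebra.extend T (corner σs c * Y) := by
  refine MonoidAlgebra.extend_corner_mul (fun σ τ => ?_) X Y
  rw [extend_corner_mul_corner, extend_corner, extend_corner]
  have h₁ := conj_mul hTcomm hTrel hσs hTσs σ τ
  have h₂ := involution_mul_add hTcomm hTrel hTσs σ τ
  linear_combination 2⁻¹ * 2⁻¹ * (c * h₂ + c * c * h₁ + (T σ * T τ - T (σ * τ)) * hc)

theorem corner_add_corner (h2 : (2 : K) ≠ 0) (σs : G) :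
    corner σs (1 : K) + corner σs (-1) = 1 := by
  rw [corner, corner, ← smul_add, neg_smul, add_add_add_comm, add_neg_cancel, add_zero,
    ← two_smul K, smul_smul, inv_mul_cancel₀ h2, one_smul]

open MonoidAlgebra in
theorem extend_corner_one (T : G → K) (σs σ : G) :
    extend T (corner σs 1 * of K G σ) = aPR T σs σ := by
  rw [extend_corner, aPR, Ring.inverse_eq_inv', one_mul, add_comm]

open MonoidAlgebra in
theorem extend_corner_neg_one (T : G → K) (h2 : (2 : K) ≠ 0) (σs σ : G) :
    extend T (corner σs (-1) * of K G σ) = dPR T σs σ := by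
  rw [extend_corner, dPR, aPR, Ring.inverse_eq_inv']
  field_simp
  ring

open MonoidAlgebra in
theorem extend_offDiag {T : G → K} (h2 : (2 : K) ≠ 0)
    (hTcomm : ∀ σ τ : G, T (σ * τ) = T (τ * σ))
    (hTrel : ∀ γ δ η : G,
      T (γ * δ * η) + T (γ * η * δ) - T (γ * η) * T δ - T (η * δ) * T γ -
        T (δ * γ) * T η + T γ * T δ * T η = 0)
    {σs : G} (hσs : σs * σs = 1) (hTσs : T σs = 0) (σ τ : G) :
    extend T (corner σs 1 * of K G σ * corner σs (-1) * of K G τ) = xPR T σs σ τ := by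
  rw [xPR, ← extend_corner_one, ← extend_corner_one, ← extend_corner_one,
    ← corner_mul hTcomm hTrel hσs hTσs (one_mul 1), map_mul (of K G), ← mul_assoc,
    PeirceForm.mul_eq_add (corner_add_corner h2 σs) (corner σs 1 * of K G σ) (of K G τ), map_add,
    add_sub_cancel_left]

end PseudoRep

open PseudoRep PeirceForm in
/-- (Irreducible case.)  If some `x(σ₀,τ₀) ≠ 0`, the matrices
`ρ(σ) = [[a(σ), x(σ,τ₀)/x(σ₀,τ₀)], [x(σ₀,σ), d(σ)]]` define a group homomorphism `G → GL₂(K)`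
with trace `T` and determinant `(1/2)(T(σ)² − T(σ²))`, which is moreover absolutely irreducible:
over any field extension `L` of `K` there is no stable line. -/
theorem irreducible_pseudoRep (T : G → K) (h2 : (2 : K) ≠ 0)
    (hT1 : T 1 = 2)
    (hTcomm : ∀ σ τ : G, T (σ * τ) = T (τ * σ))
    (hTrel : ∀ γ δ η : G,
      T (γ * δ * η) + T (γ * η * δ) - T (γ * η) * T δ - T (η * δ) * T γ -
        T (δ * γ) * T η + T γ * T δ * T η = 0)
    (σs : G) (hσs : σs ^ 2 = 1) (hTσs : T σs = 0)
    (σ₀ τ₀ : G) (hx₀ : xPR T σs σ₀ τ₀ ≠ 0) :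
    ∃ ρ : G →* Matrix.GeneralLinearGroup (Fin 2) K,
      (∀ σ : G, (ρ σ : Matrix (Fin 2) (Fin 2) K) =
        !![aPR T σs σ, xPR T σs σ τ₀ / xPR T σs σ₀ τ₀; xPR T σs σ₀ σ, dPR T σs σ]) ∧
      (∀ σ : G, Matrix.trace ((ρ σ : Matrix (Fin 2) (Fin 2) K)) = T σ) ∧
      (∀ σ : G, Matrix.det ((ρ σ : Matrix (Fin 2) (Fin 2) K)) =
        (T σ ^ 2 - T (σ ^ 2)) / 2) ∧
      (∀ (L : Type*) [Field L] (f : K →+* L),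
        ¬ ∃ v : Fin 2 → L, v ≠ 0 ∧ ∀ g : G,
          ∃ c : L, ((ρ g : Matrix (Fin 2) (Fin 2) K).map f).mulVec v = c • v) := by
  rw [pow_two] at hσs
  have hφ := MonoidAlgebra.extend_mul_comm hTcomm
  have hef := corner_add_corner h2 σs
  have he := corner_mul hTcomm hTrel hσs hTσs (one_mul (1 : K))
  have hf := corner_mul hTcomm hTrel hσs hTσs (c := (-1 : K)) (by ring)
  have hx := extend_offDiag h2 hTcomm hTrel hσs hTσs
  have ha := extend_corner_one T σs
  have hd := extend_corner_neg_one T h2 σs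
  have a_mul (σ τ : G) : aPR T σs (σ * τ) = aPR T σs σ * aPR T σs τ + xPR T σs σ τ := by
    rw [xPR, add_sub_cancel]
  have d_mul (σ τ : G) : dPR T σs (σ * τ) = dPR T σs σ * dPR T σs τ + xPR T σs τ σ := by
    simpa only [← map_mul, hx, hd] using
      diag_mul hφ hef hf (MonoidAlgebra.of K G σ) (MonoidAlgebra.of K G τ)
  have x_mul_left (σ τ υ : G) : xPR T σs (σ * τ) υ =
      aPR T σs σ * xPR T σs τ υ + xPR T σs σ υ * dPR T σs τ := by
    rw [← hx, ← hx, ← hx, ← ha, ← hd, map_mul (MonoidAlgebra.of K G)]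
    exact offDiag_mul_left hφ hef he hf _ _ _
  have x_mul_right (σ τ υ : G) : xPR T σs σ (τ * υ) =
      xPR T σs σ τ * aPR T σs υ + dPR T σs τ * xPR T σs σ υ := by
    rw [← hx, ← hx, ← hx, ← ha, ← hd, map_mul (MonoidAlgebra.of K G)]
    exact offDiag_mul_right hφ hef he hf _ _ _
  have x_mul_x (σ τ υ ω : G) : xPR T σs σ τ * xPR T σs υ ω = xPR T σs σ ω * xPR T σs υ τ := by
    rw [← hx, ← hx, ← hx, ← hx]
    exact offDiag_mul_offDiag hφ he hf _ _ _ _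
  have a_one : aPR T σs 1 = 1 := by
    rw [aPR, mul_one, hTσs, hT1, zero_add, Ring.inverse_eq_inv', inv_mul_cancel₀ h2]
  have d_one : dPR T σs 1 = 1 := by rw [dPR, a_one, hT1]; ring
  have a_inv : aPR T σs σs = 1 := by
    rw [aPR, hσs, hTσs, hT1, add_zero, Ring.inverse_eq_inv', inv_mul_cancel₀ h2]
  have d_inv : dPR T σs σs = -1 := by rw [dPR, a_inv, hTσs]; ring
  have x_one_left (τ : G) : xPR T σs 1 τ = 0 := by rw [xPR, a_one, one_mul, one_mul, sub_self]
  have x_one_right (σ : G) : xPR T σs σ 1 = 0 := by rw [xPR, a_one, mul_one, mul_one, sub_self]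
  have x_inv_left (τ : G) : xPR T σs σs τ = 0 := by
    rw [xPR, a_inv, aPR, aPR, ← mul_assoc, hσs, one_mul, one_mul, add_comm, sub_self]
  have x_inv_right (σ : G) : xPR T σs σ σs = 0 := by
    rw [xPR, a_inv, aPR, aPR, hTcomm σs, mul_assoc, hσs, mul_one, mul_one, hTcomm σ, add_comm,
      sub_self]
  let ρ : G →* Matrix (Fin 2) (Fin 2) K :=
    { toFun σ := !![aPR T σs σ, xPR T σs σ τ₀ / xPR T σs σ₀ τ₀; xPR T σs σ₀ σ, dPR T σs σ]
      map_one' := by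
        rw [a_one, d_one, x_one_left, x_one_right, zero_div, Matrix.one_fin_two]
      map_mul' σ τ := by
        have h := x_mul_x σ τ₀ σ₀ τ
        have h' := x_mul_x σ₀ σ τ τ₀
        rw [Matrix.mul_fin_two, a_mul, d_mul, x_mul_left, x_mul_right]
        congr! 3
        · field_simp
          linear_combination -h
        · field_simp
        · congr! 2
          field_simp
          linear_combination -h' }
  have hρ (σ : G) : ρ σ =
      !![aPR T σs σ, xPR T σs σ τ₀ / xPR T σs σ₀ τ₀; xPR T σs σ₀ σ, dPR T σs σ] := rfl
  refine ⟨ρ.toHomUnits, hρ, fun σ => ?_, fun σ => ?_, ?_⟩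
  · rw [MonoidHom.coe_toHomUnits, hρ, Matrix.trace_fin_two_of, dPR, add_sub_cancel]
  · have h := x_mul_x σ τ₀ σ₀ σ
    have hT (υ : G) : T υ = aPR T σs υ + dPR T σs υ := by rw [dPR, add_sub_cancel]
    rw [MonoidHom.coe_toHomUnits, hρ, Matrix.det_fin_two_of, hT, hT (σ ^ 2), pow_two σ, a_mul,
      d_mul]
    field_simp
    linear_combination (-2) * h
  · rintro L _ f ⟨v, hv, hstable⟩
    have hentry (g : G) : ∃ c : L,
        f (aPR T σs g) * v 0 + f (xPR T σs g τ₀ / xPR T σs σ₀ τ₀) * v 1 = c * v 0 ∧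
        f (xPR T σs σ₀ g) * v 0 + f (dPR T σs g) * v 1 = c * v 1 := by
      obtain ⟨c, hc⟩ := hstable g
      rw [MonoidHom.coe_toHomUnits, hρ] at hc
      refine ⟨c, ?_, ?_⟩
      · simpa [Matrix.mulVec, dotProduct, Fin.sum_univ_two] using congrFun hc 0
      · simpa [Matrix.mulVec, dotProduct, Fin.sum_univ_two] using congrFun hc 1
    have hdiag : v 0 = 0 ∨ v 1 = 0 := by
      obtain ⟨c, h₀, h₁⟩ := hentry σs
      simp only [a_inv, d_inv, x_inv_left, x_inv_right, zero_div, map_zero, map_one, map_neg,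
        zero_mul, one_mul, add_zero, zero_add] at h₀ h₁
      have h2L : (2 : L) ≠ 0 := map_ofNat f 2 ▸ (map_ne_zero f).2 h2
      have h : 2 * (v 0 * v 1) = 0 := by linear_combination v 1 * h₀ - v 0 * h₁
      exact mul_eq_zero.1 ((mul_eq_zero.1 h).resolve_left h2L)
    refine hv (funext fun i => ?_)
    suffices h : v 0 = 0 ∧ v 1 = 0 by
      fin_cases i
      exacts [h.1, h.2]
    rcases hdiag with h | h
    · obtain ⟨c, h₀, -⟩ := hentry σ₀
      exact ⟨h, by simpa [h, div_self hx₀] using h₀⟩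
    · obtain ⟨c, -, h₁⟩ := hentry τ₀
      exact ⟨by simpa [h, hx₀] using h₁, h⟩

end PseudoRep
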